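/- (Corollary to Lemma 1) Let n ≥ 1 and let q be the largest prime dividing g(n). If p and p' are distinct primes with p < q/2 and p' < q/2, then at least one of p and p' divides g(n); in other words, at most one prime less than q/2 fails to divide g(n). -/

import Mathlib

/-- `g n` is the maximal order of an element of the symmetric group on `n` letters. -/
noncomputable def g (n : ℕ) : ℕ :=
  Finset.univ.sup (fun σ : Equiv.Perm (Fin n) => orderOf σ)

theorem orderOf_le_g {n : ℕ} (σ : Equiv.Perm (Fin n)) : orderOf σ ≤ g n :=
  Finset.le_sup (f := fun σ : Equiv.Perm (Fin n) => orderOf σ) (Finset.mem_univ σ)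

theorem exists_orderOf_eq_g (n : ℕ) : ∃ σ : Equiv.Perm (Fin n), orderOf σ = g n := by
  obtain ⟨σ, -, h⟩ := Finset.exists_mem_eq_sup Finset.univ Finset.univ_nonempty
    (fun σ : Equiv.Perm (Fin n) => orderOf σ)
  exact ⟨σ, h.symm⟩

theorem lcm_le_g {n : ℕ} {s : Multiset ℕ} (hsum : s.sum ≤ n) (hs : ∀ a ∈ s, 2 ≤ a) :
    s.lcm ≤ g n := by
  obtain ⟨σ, rfl⟩ := (Equiv.Perm.exists_with_cycleType_iff (Fin n)).2
    ⟨by simpa using hsum, hs⟩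
  rw [Equiv.Perm.lcm_cycleType]
  exact orderOf_le_g σ

theorem Nat.Prime.exists_mem_dvd_of_dvd_lcm {q : ℕ} (hq : q.Prime) {s : Multiset ℕ}
    (h : q ∣ s.lcm) : ∃ c ∈ s, q ∣ c := by
  induction s using Multiset.induction_on with
  | empty => simp [hq.one_lt.ne'] at h
  | cons a s ih =>
    rw [Multiset.lcm_cons] at h
    rcases hq.dvd_mul.1 (h.trans (Nat.lcm_dvd_mul a s.lcm)) with h | h
    · exact ⟨a, by simp, h⟩
    · obtain ⟨c, hc, hqc⟩ := ih h
      exact ⟨c, by simp [hc], hqc⟩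

/-- Dividing the lcm of `s` by (at most) a prime divisor `q` frees up `q` in the sum. -/
theorem exists_multiset_sum_add_prime_le {q : ℕ} (hq : q.Prime) {s : Multiset ℕ}
    (hs : ∀ a ∈ s, 2 ≤ a) (h : q ∣ s.lcm) :
    ∃ t : Multiset ℕ, (∀ a ∈ t, 2 ≤ a) ∧ t.sum + q ≤ s.sum ∧ t.lcm ∣ s.lcm ∧
      s.lcm ∣ q * t.lcm := by
  obtain ⟨c, hc, m, rfl⟩ := hq.exists_mem_dvd_of_dvd_lcm h
  obtain ⟨t, rfl⟩ := Multiset.exists_cons_of_mem hc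
  have hc2 : 2 ≤ q * m := hs _ (by simp)
  have ht : ∀ a ∈ t, 2 ≤ a := fun a ha => hs a (by simp [ha])
  rcases Nat.lt_or_ge m 2 with hm | hm
  · obtain rfl : m = 1 := by
      interval_cases m <;> omega
    refine ⟨t, ht, by simp [add_comm], ?_, ?_⟩
    · rw [Multiset.lcm_cons]
      exact dvd_lcm_right _ _
    · rw [Multiset.lcm_cons, mul_one]
      exact Nat.lcm_dvd_mul _ _
  · refine ⟨m ::ₘ t, ?_, ?_, ?_, ?_⟩
    · simpa [hm] using ht
    · have := hq.two_le
      simp only [Multiset.sum_cons]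
      nlinarith
    · simp only [Multiset.lcm_cons]
      exact lcm_dvd_lcm (dvd_mul_left _ _) dvd_rfl
    · simp only [Multiset.lcm_cons]
      exact lcm_dvd (mul_dvd_mul_left _ (dvd_lcm_left _ _))
        ((dvd_lcm_right _ _).trans (dvd_mul_left _ _))

theorem exists_pow_add_le_lt_pow_mul {p p' q : ℕ} (hp : p.Prime) (hlt : p < p')
    (hq : q.Prime) (hq2 : 2 * p' < q) : ∃ k, k ≠ 0 ∧ p ^ k + p' ≤ q ∧ q < p ^ k * p' := by
  have hp2 := hp.two_le
  have hex : ∃ k, q < p ^ k * p' := by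
    obtain ⟨k, hk⟩ := pow_unbounded_of_one_lt q hp.one_lt
    exact ⟨k, hk.trans_le (Nat.le_mul_of_pos_right _ (by omega))⟩
  have hspec := Nat.find_spec hex
  have hmin := fun m => @Nat.find_min _ _ hex m
  generalize Nat.find hex = k at hspec hmin
  refine ⟨k, ?_, ?_, hspec⟩
  · rintro rfl
    simp at hspec
    omega
  · rcases k with _ | _ | j
    · simp; omega
    · simp; omega
    · have h := not_lt.1 (hmin (j + 1) (by omega))
      obtain ⟨d, rfl⟩ := Nat.exists_eq_add_of_lt hlt
      rcases Nat.eq_zero_or_pos d with rfl | hd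
      · rcases Nat.eq_zero_or_pos j with rfl | hj
        · have hne : p * (p + 1) ≠ q := by
            rintro rfl
            exact Nat.not_prime_mul (by omega) (by omega) hq
          have h : p * (p + 1) < q := lt_of_le_of_ne (by simpa using h) hne
          calc p ^ (0 + 1 + 1) + (p + 0 + 1) = p * (p + 1) + 1 := by ring
            _ ≤ q := h
        · have : p ^ 2 ≤ p ^ (j + 1) := Nat.pow_le_pow_right (by omega) (by omega)
          have : p ^ (j + 1 + 1) = p ^ (j + 1) * p := pow_succ _ _
          nlinarith
      · have h1 : p ≤ p ^ (j + 1) := Nat.le_self_pow (by omega) _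
        have h2 : p ^ (j + 1 + 1) = p ^ (j + 1) * p := pow_succ _ _
        nlinarith [Nat.mul_le_mul_right d h1]

theorem dvd_g_or_dvd_g_of_lt {n p p' q : ℕ} (hp : p.Prime) (hp' : p'.Prime) (hq : q.Prime)
    (hqdvd : q ∣ g n) (hlt : p < p') (hq2 : 2 * p' < q) : p ∣ g n ∨ p' ∣ g n := by
  by_contra! hnot
  obtain ⟨σ, hσ⟩ := exists_orderOf_eq_g n
  rw [← Equiv.Perm.lcm_cycleType] at hσ
  obtain ⟨t, ht, hsum, htdvd, hdvd⟩ := exists_multiset_sum_add_prime_le hq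
    (fun a ha => Equiv.Perm.two_le_of_mem_cycleType ha) (hσ ▸ hqdvd)
  rw [hσ] at htdvd hdvd
  obtain ⟨k, hk, hle, hgt⟩ := exists_pow_add_le_lt_pow_mul hp hlt hq hq2
  have hσn : σ.cycleType.sum ≤ n := by
    simpa using σ.sum_cycleType_le
  have hmax : (p ^ k ::ₘ p' ::ₘ t).lcm ≤ g n := by
    refine lcm_le_g (by simp only [Multiset.sum_cons]; omega) ?_
    simp only [Multiset.mem_cons, forall_eq_or_imp]
    exact ⟨hp.two_le.trans (Nat.le_self_pow hk _), hp'.two_le, ht⟩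
  have hc' : Nat.Coprime p' t.lcm :=
    (hp'.coprime_iff_not_dvd.2 hnot.2).coprime_dvd_right htdvd
  have hc : Nat.Coprime (p ^ k) (p' * t.lcm) :=
    Nat.Coprime.pow_left _ (((Nat.coprime_primes hp hp').2 hlt.ne).mul_right
      ((hp.coprime_iff_not_dvd.2 hnot.1).coprime_dvd_right htdvd))
  have hlcm : (p ^ k ::ₘ p' ::ₘ t).lcm = p ^ k * (p' * t.lcm) := by
    rw [Multiset.lcm_cons, Multiset.lcm_cons]
    exact (congrArg _ hc'.lcm_eq_mul).trans hc.lcm_eq_mul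
  have hpos : 0 < t.lcm := by
    refine Nat.pos_of_ne_zero fun h0 => ?_
    rw [Multiset.lcm_eq_zero_iff] at h0
    exact absurd (ht 0 h0) (by norm_num)
  have hub : g n ≤ q * t.lcm := Nat.le_of_dvd (Nat.mul_pos hq.pos hpos) hdvd
  have := Nat.mul_lt_mul_of_pos_right hgt hpos
  rw [hlcm, ← mul_assoc] at hmax
  omega

theorem at_most_one_small_prime_not_dvd (n : ℕ) (hn : 1 ≤ n) (q : ℕ)
    (hq : q.Prime) (hqdvd : q ∣ g n)
    (hqmax : ∀ r : ℕ, r.Prime → r ∣ g n → r ≤ q)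
    (p p' : ℕ) (hp : p.Prime) (hp' : p'.Prime) (hpp' : p ≠ p')
    (hplt : (p : ℝ) < q / 2) (hp'lt : (p' : ℝ) < q / 2) :
    p ∣ g n ∨ p' ∣ g n := by
  have h : 2 * p < q := by
    have : (2 * p : ℝ) < q := by linarith
    exact_mod_cast this
  have h' : 2 * p' < q := by
    have : (2 * p' : ℝ) < q := by linarith
    exact_mod_cast this
  rcases hpp'.lt_or_gt with hlt | hlt
  · exact dvd_g_or_dvd_g_of_lt hp hp' hq hqdvd hlt h'
  · exact (dvd_g_or_dvd_g_of_lt hp' hp hq hqdvd hlt h).symm
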